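/- For every prime power q, the distant graph G(M₂(q),Δ) (equivalently, the graph of complementary 2-subspaces of F_q^4) admits a partition of its vertex set into q² + q + 1 pairwise vertex-disjoint maximal cliques, each of size q² + 1. -/

import Mathlib

open Module

section Framework

variable {F V : Type*} [Field F] [AddCommGroup V] [Module F V]

theorem exists_mem_ne_zero_of_plane {W : Submodule F V} (hW : finrank F W = 2) :
    ∃ v ∈ W, v ≠ 0 := by
  refine W.ne_bot_iff.1 ?_
  rintro rfl
  simp at hW

theorem isCompl_of_disjoint_planes (hV : finrank F V = 4) {X Y : Submodule F V}
    (hX : finrank F X = 2) (hY : finrank F Y = 2) (h : Disjoint X Y) : IsCompl X Y := by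
  have : FiniteDimensional F V := .of_finrank_pos (by omega)
  refine ⟨h, codisjoint_iff.2 (Submodule.eq_top_of_finrank_eq ?_)⟩
  have := Submodule.finrank_sup_add_finrank_inf_eq X Y
  rw [h.eq_bot, finrank_bot] at this
  omega

variable [Fintype F]

/-- In a 4-dimensional space, a nonzero vector lies on at most `q² + q + 1` planes. -/
theorem natCard_planes_through_le (hV : finrank F V = 4) {v : V} (hv : v ≠ 0) :
    Nat.card {W : Submodule F V // finrank F W = 2 ∧ v ∈ W} ≤
      Fintype.card F ^ 2 + Fintype.card F + 1 := by
  have : FiniteDimensional F V := .of_finrank_pos (by omega)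
  have hspan : finrank F (F ∙ v) = 1 := finrank_span_singleton hv
  have hquot : finrank F (V ⧸ F ∙ v) = 3 := by
    have := (F ∙ v).finrank_quotient_add_finrank
    omega
  have : Finite (V ⧸ F ∙ v) := Module.finite_of_finite F
  have hcard : Nat.card {H : Submodule F (V ⧸ F ∙ v) // finrank F H = 1} =
      Fintype.card F ^ 2 + Fintype.card F + 1 := by
    rw [← Nat.card_congr (Projectivization.equivSubmodule F (V ⧸ F ∙ v)),
      Projectivization.card_of_finrank F _ hquot]
    simp [Finset.sum_range_succ]
    ring
  have hle (W : {W : Submodule F V // finrank F W = 2 ∧ v ∈ W}) : F ∙ v ≤ W.1 :=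
    (Submodule.span_singleton_le_iff_mem v W.1).2 W.2.2
  rw [← hcard]
  refine Nat.card_le_card_of_injective (fun W ↦ ⟨W.1.map (F ∙ v).mkQ, ?_⟩) ?_
  · have h := ((F ∙ v).mkQ.domRestrict W.1).finrank_range_add_finrank_ker
    rw [LinearMap.range_domRestrict, LinearMap.ker_domRestrict, Submodule.ker_mkQ,
      (Submodule.comapSubtypeEquivOfLe (hle W)).finrank_eq, hspan, W.2.1] at h
    omega
  · intro W W' h
    have h' := congrArg (Submodule.comap (F ∙ v).mkQ) (congrArg Subtype.val h)
    simp only [Submodule.comap_map_mkQ, sup_eq_right.2 (hle _)] at h'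
    exact Subtype.ext h'

theorem natCard_spread (hV : finrank F V = 4) {T : Type*} (P : T → Submodule F V)
    (hP : ∀ t, finrank F (P t) = 2) (huniq : ∀ v, v ≠ 0 → ∃! t, v ∈ P t) :
    Nat.card T = Fintype.card F ^ 2 + 1 := by
  have : FiniteDimensional F V := .of_finrank_pos (by omega)
  have : Finite V := Module.finite_of_finite F
  have hne (t : T) : ∃ v ∈ P t, v ≠ 0 := exists_mem_ne_zero_of_plane (hP t)
  have : Finite T := by
    choose g hg hg0 using hne
    exact Finite.of_injective g fun s t h ↦
      (huniq (g s) (hg0 s)).unique (hg s) (h ▸ hg t)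
  have := Fintype.ofFinite T
  let e : {v : V // v ≠ 0} ≃ Σ t, {v : P t // v ≠ 0} :=
    { toFun v := ⟨(huniq v.1 v.2).choose, ⟨v.1, (huniq v.1 v.2).choose_spec.1⟩,
        fun h ↦ v.2 (congrArg Subtype.val h)⟩
      invFun x := ⟨x.2.1, fun h ↦ x.2.2 (Subtype.ext h)⟩
      left_inv v := rfl
      right_inv := by
        rintro ⟨t, ⟨v, hvt⟩, hv⟩
        have hv' : v ≠ 0 := fun h ↦ hv (Subtype.ext h)
        obtain rfl : t = (huniq v hv').choose := (huniq v hv').choose_spec.2 t hvt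
        rfl }
  have hcount {M : Type _} [AddCommGroup M] [Finite M] :
      Nat.card {v : M // v ≠ 0} = Nat.card M - 1 := by
    have := Fintype.ofFinite M
    classical
    simp [Fintype.card_subtype_compl]
  have h := Nat.card_congr e
  rw [Nat.card_sigma, hcount, Finset.sum_congr rfl fun t _ ↦ hcount (M := P t),
    Finset.sum_congr rfl fun t _ ↦ by rw [Module.natCard_eq_pow_finrank (K := F), hP],
    Module.natCard_eq_pow_finrank (K := F), hV] at h
  simp only [Finset.sum_const, Finset.card_univ, smul_eq_mul, Nat.card_eq_fintype_card] at h
  rw [Nat.card_eq_fintype_card]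
  have hq : 1 < Fintype.card F := Fintype.one_lt_card
  have hq2 : 1 < Fintype.card F ^ 2 := Nat.one_lt_pow two_ne_zero hq
  obtain ⟨k, hk⟩ := Nat.exists_eq_add_of_lt hq2
  rw [show Fintype.card F ^ 4 = (Fintype.card F ^ 2) ^ 2 by ring, hk] at h
  rw [hk]
  have h1 : (1 + k + 1) ^ 2 - 1 = (1 + k + 1 + 1) * (k + 1) := by
    rw [Nat.sub_eq_iff_eq_add (Nat.one_le_pow _ _ (by omega))]; ring
  rw [h1, show 1 + k + 1 - 1 = k + 1 by omega] at h
  exact (Nat.eq_of_mul_eq_mul_right (by omega) h).symm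

/-- Pairwise disjoint families of planes, as many as there are planes through a point and each
covering all nonzero vectors, partition the planes into spreads. -/
theorem exists_spread_partition (hV : finrank F V = 4) {C : Type*} [Finite C]
    (hC : Nat.card C = Fintype.card F ^ 2 + Fintype.card F + 1) (S : C → Set (Submodule F V))
    (hcover : ∀ c v, v ≠ 0 → ∃ W ∈ S c, finrank F W = 2 ∧ v ∈ W)
    (hdisj : ∀ c c' W, W ∈ S c → W ∈ S c' → c = c') :
    ∃ f : {W : Submodule F V // finrank F W = 2} → C,
      ∀ c v, v ≠ 0 → ∃! W, f W = c ∧ v ∈ W.1 := by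
  have : FiniteDimensional F V := .of_finrank_pos (by omega)
  have : Finite V := Module.finite_of_finite F
  have hbij (v : V) (hv : v ≠ 0) (g : C → {W : Submodule F V // finrank F W = 2 ∧ v ∈ W})
      (hg : ∀ c, (g c).1 ∈ S c) : Function.Bijective g := by
    refine (Nat.bijective_iff_injective_and_card g).2 ⟨fun c c' h ↦ ?_, le_antisymm ?_ ?_⟩
    · exact hdisj c c' (g c).1 (hg c) (h ▸ hg c')
    · exact Nat.card_le_card_of_injective g fun c c' h ↦ hdisj c c' (g c).1 (hg c) (h ▸ hg c')
    · exact hC ▸ natCard_planes_through_le hV hv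
  have hline (v : V) (hv : v ≠ 0) :
      ∃ g : C → {W : Submodule F V // finrank F W = 2 ∧ v ∈ W}, ∀ c, (g c).1 ∈ S c := by
    choose W hS hW using fun c ↦ hcover c v hv
    exact ⟨fun c ↦ ⟨W c, hW c⟩, hS⟩
  have hcolor (W : {W : Submodule F V // finrank F W = 2}) : ∃ c, W.1 ∈ S c := by
    obtain ⟨v, hvW, hv⟩ := exists_mem_ne_zero_of_plane W.2
    obtain ⟨g, hg⟩ := hline v hv
    obtain ⟨c, hc⟩ := (hbij v hv g hg).2 ⟨W.1, W.2, hvW⟩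
    exact ⟨c, by simpa [hc] using hg c⟩
  choose f hf using hcolor
  refine ⟨f, fun c v hv ↦ ?_⟩
  obtain ⟨g, hg⟩ := hline v hv
  refine ⟨⟨(g c).1, (g c).2.1⟩, ⟨hdisj _ _ _ (hf _) (hg c), (g c).2.2⟩, ?_⟩
  rintro W ⟨rfl, hvW⟩
  obtain ⟨c', hc'⟩ := (hbij v hv g hg).2 ⟨W.1, W.2, hvW⟩
  have h1 : (g c').1 = W.1 := congrArg Subtype.val hc'
  obtain rfl : c' = f W := hdisj _ _ _ (hg c') (h1 ▸ hf W)
  exact Subtype.ext h1.symm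

theorem exists_clique_partition (hV : finrank F V = 4) {C : Type*} [Finite C]
    (hC : Nat.card C = Fintype.card F ^ 2 + Fintype.card F + 1) (S : C → Set (Submodule F V))
    (hcover : ∀ c v, v ≠ 0 → ∃ W ∈ S c, finrank F W = 2 ∧ v ∈ W)
    (hdisj : ∀ c c' W, W ∈ S c → W ∈ S c' → c = c') :
    ∃ f : {W : Submodule F V // finrank F W = 2} →
        Fin (Fintype.card F ^ 2 + Fintype.card F + 1),
      ∀ c,
        (∀ X Y, f X = c → f Y = c → X ≠ Y → IsCompl X.1 Y.1) ∧
        Nat.card {X // f X = c} = Fintype.card F ^ 2 + 1 ∧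
        (∀ X, f X ≠ c → ∃ Y, f Y = c ∧ ¬IsCompl X.1 Y.1) := by
  obtain ⟨f, hf⟩ := exists_spread_partition hV hC S hcover hdisj
  let e : C ≃ Fin (Fintype.card F ^ 2 + Fintype.card F + 1) := Finite.equivFinOfCardEq hC
  refine ⟨e ∘ f, fun c ↦ ?_⟩
  simp only [Function.comp_apply, ne_eq, ← e.eq_symm_apply]
  refine ⟨fun X Y hX hY hXY ↦ ?_, ?_, fun X _ ↦ ?_⟩
  · refine isCompl_of_disjoint_planes hV X.2 Y.2 (Submodule.disjoint_def.2 fun v hvX hvY ↦ ?_)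
    by_contra hv
    exact hXY ((hf _ v hv).unique ⟨hX, hvX⟩ ⟨hY, hvY⟩)
  · refine natCard_spread hV (fun X : {X // f X = e.symm c} ↦ X.1.1) (fun X ↦ X.1.2)
      fun v hv ↦ ?_
    obtain ⟨W, ⟨hW, hvW⟩, huniq⟩ := hf (e.symm c) v hv
    exact ⟨⟨W, hW⟩, hvW, fun Y hY ↦ Subtype.ext (huniq Y.1 ⟨Y.2, hY⟩)⟩
  · obtain ⟨v, hvX, hv⟩ := exists_mem_ne_zero_of_plane X.2
    obtain ⟨W, ⟨hW, hvW⟩, -⟩ := hf (e.symm c) v hv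
    exact ⟨W, hW, fun h ↦ hv (Submodule.disjoint_def.1 h.disjoint v hvX hvW)⟩

end Framework

section QuadraticExtension

variable {F K : Type*} [Field F] [Field K] [Algebra F K]

theorem exists_smul_add_smul_eq (hK : finrank F K = 2) {x y : K} (hx : x ≠ 0)
    (hxy : ∀ a : F, a • x ≠ y) (z : K) : ∃ a b : F, a • x + b • y = z := by
  have : FiniteDimensional F K := .of_finrank_pos (by omega)
  have hli : LinearIndependent F ![x, y] := (LinearIndependent.pair_iff' hx).2 hxy
  have htop := hli.span_eq_top_of_card_eq_finrank' (by simp [hK])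
  rw [Matrix.range_cons_cons_empty] at htop
  exact Submodule.mem_span_pair.1 (htop ▸ Submodule.mem_top)

theorem eq_and_eq_of_smul_add_smul_eq {x y : K} (hx : x ≠ 0) (hxy : ∀ a : F, a • x ≠ y)
    {a b a' b' : F} (h : a • x + b • y = a' • x + b' • y) : a = a' ∧ b = b' := by
  have hli := LinearIndependent.pair_iff.1 ((LinearIndependent.pair_iff' hx).2 hxy)
    (a - a') (b - b') (by rw [sub_smul, sub_smul]; linear_combination h)
  exact ⟨sub_eq_zero.1 hli.1, sub_eq_zero.1 hli.2⟩

/-- The plane spanned by `(w, e w)` and `(0, d w)`. -/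
noncomputable def shearedPlane (F : Type*) {K : Type*} [Field F] [Field K] [Algebra F K]
    (d e w : K) : Submodule F (K × K) :=
  LinearMap.range ((LinearMap.toSpanSingleton F (K × K) (w, e * w)).coprod
    (LinearMap.toSpanSingleton F (K × K) (0, d * w)))

theorem mem_shearedPlane {d e w : K} {p : K × K} :
    p ∈ shearedPlane F d e w ↔ ∃ a b : F, p.1 = a • w ∧ p.2 = a • (e * w) + b • (d * w) := by
  simp [shearedPlane, Prod.ext_iff, eq_comm]

theorem finrank_shearedPlane {d w : K} (hd : d ≠ 0) (hw : w ≠ 0) (e : K) :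
    finrank F (shearedPlane F d e w) = 2 := by
  rw [shearedPlane, LinearMap.finrank_range_of_inj]
  · simp
  · rw [injective_iff_map_eq_zero]
    rintro ⟨a, b⟩ h
    simp only [LinearMap.coprod_apply, LinearMap.toSpanSingleton_apply, Prod.smul_mk,
      Prod.mk_add_mk, smul_zero, add_zero, Prod.mk_eq_zero, smul_eq_zero, hw, or_false] at h
    obtain ⟨rfl, h⟩ := h
    simpa [hd, hw] using h

/-- Representatives of the `F`-directions of `K`. -/
def direction (θ : K) : Option F → K
  | none => 1
  | some t => t • 1 + θ

/-- A complement of each direction of `K`. -/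
def transversal (θ : K) : Option F → K
  | none => θ
  | some _ => 1

theorem direction_ne_zero {θ : K} (hθ : ∀ a : F, a • (1 : K) ≠ θ) (t : Option F) :
    direction θ t ≠ 0 := by
  cases t with
  | none => exact one_ne_zero
  | some t =>
    intro h
    apply hθ (-t)
    rw [neg_smul]
    exact neg_eq_of_add_eq_zero_right h

theorem eq_and_eq_of_smul_direction_eq {θ : K} (hθ : ∀ a : F, a • (1 : K) ≠ θ)
    {t t' : Option F} {v v' : F} (hv : v ≠ 0)
    (h : v • direction θ t = v' • direction θ t') : t = t' ∧ v = v' := by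
  have key {a b a' b' : F} := eq_and_eq_of_smul_add_smul_eq (F := F) (one_ne_zero (α := K)) hθ
    (a := a) (b := b) (a' := a') (b' := b')
  cases t with
  | none =>
    cases t' with
    | none => exact ⟨rfl, by simpa using (key (b := 0) (b' := 0) (by simpa [direction] using h)).1⟩
    | some t' =>
      have := key (a := v) (b := 0) (a' := v' * t') (b' := v')
        (by simpa [direction, mul_smul, smul_add] using h)
      grind
  | some t =>
    cases t' with
    | none =>
      have := key (a := v * t) (b := v) (a' := v') (b' := 0)
        (by simpa [direction, mul_smul, smul_add] using h)
      grind
    | some t' =>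
      have := key (a := v * t) (b := v) (a' := v' * t') (b' := v')
        (by simpa [direction, mul_smul, smul_add] using h)
      grind

theorem eq_of_smul_transversal_add_eq {θ : K} (hθ : ∀ a : F, a • (1 : K) ≠ θ)
    {t : Option F} {r r' u u' : F}
    (h : r • transversal θ t + u • direction θ t = r' • transversal θ t + u' • direction θ t) :
    r = r' := by
  have key {a b a' b' : F} := eq_and_eq_of_smul_add_smul_eq (F := F) (one_ne_zero (α := K)) hθ
    (a := a) (b := b) (a' := a') (b' := b')
  cases t with
  | none =>
    exact (key (a := u) (a' := u') (by simpa [transversal, direction, add_comm] using h)).2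
  | some t =>
    have := key (a := r + u * t) (b := u) (a' := r' + u' * t) (b' := u')
      (by simpa [direction, transversal, mul_smul, smul_add, add_smul, add_assoc] using h)
    grind

variable [Fintype F]

theorem algebraMap_pow_card (a : F) :
    algebraMap F K a ^ Fintype.card F = algebraMap F K a := by
  rw [← map_pow, FiniteField.pow_card]

theorem exists_pow_card_ne_self (hK : finrank F K = 2) :
    ∃ θ : K, θ ^ Fintype.card F ≠ θ := by
  have : FiniteDimensional F K := .of_finrank_pos (by omega)
  have : Finite K := Module.finite_of_finite F
  by_contra! h
  have h1 : FiniteField.frobeniusAlgHom F K = 1 := AlgHom.ext h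
  have := FiniteField.orderOf_frobeniusAlgHom F K
  rw [h1, orderOf_one] at this
  omega

theorem smul_one_ne_of_pow_card_ne {θ : K} (hθ : θ ^ Fintype.card F ≠ θ) (a : F) :
    a • (1 : K) ≠ θ := by
  rintro rfl
  rw [← Algebra.algebraMap_eq_smul_one] at hθ
  exact hθ (algebraMap_pow_card a)

theorem add_pow_card (x y : K) :
    (x + y) ^ Fintype.card F = x ^ Fintype.card F + y ^ Fintype.card F :=
  map_add (FiniteField.frobeniusAlgHom F K) x y

theorem pow_card_pow_card (hK : finrank F K = 2) (x : K) :
    (x ^ Fintype.card F) ^ Fintype.card F = x := by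
  have : FiniteDimensional F K := .of_finrank_pos (by omega)
  have : Finite K := Module.finite_of_finite F
  have := Fintype.ofFinite K
  rw [← pow_mul, ← sq, ← hK, ← Module.card_eq_pow_finrank, FiniteField.pow_card]

/-- The twisted polynomial `s x + c x ^ q` with `c ≠ 0` can be chosen without eigenvalues in
`F`, as soon as `F` has more than two elements. -/
theorem exists_twisted_without_eigenvalue (hK : finrank F K = 2) (hF : 2 < Fintype.card F) :
    ∃ s c : K, c ≠ 0 ∧ ∀ x : K, x ≠ 0 → ∀ a : F, a • x ≠ s * x + c * x ^ Fintype.card F := by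
  have : FiniteDimensional F K := .of_finrank_pos (by omega)
  have : Finite K := Module.finite_of_finite F
  have := Fintype.ofFinite K
  have hcard : Fintype.card K = Fintype.card F ^ 2 := by
    rw [Module.card_eq_pow_finrank (K := F), hK]
  simp only [Algebra.smul_def]
  by_cases h2 : ringChar K = 2
  · have : CharP K 2 := ringChar.of_eq h2
    have htwo : (2 : K) = 0 := CharP.cast_eq_zero K 2
    obtain ⟨s, hs⟩ := exists_pow_card_ne_self hK
    obtain ⟨τ, hτ⟩ : ∃ τ, τ = s + s ^ Fintype.card F := ⟨_, rfl⟩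
    have hτq : τ ^ Fintype.card F = τ := by
      rw [hτ, add_pow_card, pow_card_pow_card hK, add_comm]
    obtain ⟨a, ha0, haτ⟩ : ∃ a : F, a ≠ 0 ∧ algebraMap F K a ≠ τ := by
      classical
      by_contra! h
      have hsub : (Finset.univ.erase (0 : F)).card ≤ 1 := Finset.card_le_one.2 fun a ha b hb ↦
        (algebraMap F K).injective
          ((h a (Finset.ne_of_mem_erase ha)).trans (h b (Finset.ne_of_mem_erase hb)).symm)
      rw [Finset.card_erase_of_mem (Finset.mem_univ _), Finset.card_univ] at hsub
      omega
    obtain ⟨A, hA⟩ : ∃ A, A = algebraMap F K a := ⟨_, rfl⟩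
    have hAq : A ^ Fintype.card F = A := hA ▸ algebraMap_pow_card a
    have hA0 : A ≠ 0 := by simpa [hA] using ha0
    obtain ⟨c, hc⟩ := FiniteField.isSquare_of_char_two h2 (A * (A + τ))
    have hcq : c ^ Fintype.card F = c := by
      have h : (c ^ Fintype.card F - c) ^ 2 = 0 := by
        have h1 : c ^ Fintype.card F * c ^ Fintype.card F = c * c := by
          rw [← mul_pow, ← hc, mul_pow, add_pow_card, hAq, hτq]
        linear_combination h1 + (c * c - c * c ^ Fintype.card F) * htwo
      exact sub_eq_zero.1 (pow_eq_zero_iff two_ne_zero |>.1 h)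
    refine ⟨s, c, ?_, fun x hx f h ↦ ?_⟩
    · rintro rfl
      rw [mul_zero, mul_eq_zero] at hc
      rcases hc with hc | hc
      · exact hA0 hc
      · exact haτ (by linear_combination hc - τ * htwo - hA)
    · obtain ⟨f', hf'⟩ : ∃ f', f' = algebraMap F K f := ⟨_, rfl⟩
      rw [← hf'] at h
      have hfq : f' ^ Fintype.card F = f' := hf' ▸ algebraMap_pow_card f
      have hx' : x ^ Fintype.card F ≠ 0 := pow_ne_zero _ hx
      have h' := congrArg (· ^ Fintype.card F) h
      simp only [add_pow_card, mul_pow, pow_card_pow_card hK, hcq, hfq] at h'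
      have h3 : (f' - s) * (f' - s ^ Fintype.card F) = c * c := by
        refine mul_right_cancel₀ (mul_ne_zero hx hx') ?_
        linear_combination ((f' - s ^ Fintype.card F) * x ^ Fintype.card F) * h +
          c * x ^ Fintype.card F * h'
      have h4 : (f' + s - A) * (f' + s ^ Fintype.card F - A) = 0 := by
        linear_combination h3 - hc - A * hτ +
          (f' * s + f' * s ^ Fintype.card F - A * f' - A * s - A * s ^ Fintype.card F +
            A * A + A * τ) * htwo
      rcases mul_eq_zero.1 h4 with h5 | h5
      · apply hs
        have h6 : s = A + f' := by linear_combination h5 - f' * htwo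
        rw [h6, add_pow_card, hAq, hfq]
      · apply hs
        have h6 : s ^ Fintype.card F = A + f' := by linear_combination h5 - f' * htwo
        have h7 := congrArg (· ^ Fintype.card F) h6
        simp only [pow_card_pow_card hK, add_pow_card, hAq, hfq] at h7
        rw [h6, h7]
  · obtain ⟨c, hc⟩ := FiniteField.exists_nonsquare h2
    refine ⟨0, c, fun h ↦ hc (h ▸ IsSquare.zero), fun x hx f h ↦ hc ?_⟩
    have hodd : Odd (Fintype.card F) := by
      rw [← Nat.not_even_iff_odd]
      intro he
      have := FiniteField.odd_card_of_char_ne_two h2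
      rw [hcard] at this
      exact absurd ((Nat.even_pow.2 ⟨he, two_ne_zero⟩)) (by simpa [Nat.even_iff] using this)
    obtain ⟨k, hk⟩ := hodd
    have hxk : x ^ k ≠ 0 := pow_ne_zero _ hx
    have hcf : c = algebraMap F K f * ((x ^ k)⁻¹ * (x ^ k)⁻¹) := by
      field_simp
      refine mul_right_cancel₀ hx ?_
      rw [h, hk]
      ring
    rw [hcf]
    refine IsSquare.mul ?_ ⟨_, rfl⟩
    by_cases hf : f = 0
    · simp [hf]
    · rw [FiniteField.isSquare_iff h2 (by simpa using hf), hcard,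
        show Fintype.card F ^ 2 / 2 = (Fintype.card F - 1) * (k + 1) by
          rw [hk, show (2 * k + 1) ^ 2 = 2 * ((2 * k + 1 - 1) * (k + 1)) + 1 by
            rw [Nat.add_sub_cancel]; ring]
          omega,
        pow_mul, ← map_pow, FiniteField.pow_card_sub_one_eq_one f hf, map_one, one_pow]

/-- The graph of `x ↦ α x + β x ^ q`. -/
noncomputable def twistedGraph (F : Type*) {K : Type*} [Field F] [Fintype F] [Field K]
    [Algebra F K] (α β : K) : Submodule F (K × K) :=
  (LinearMap.mulLeft F α +
    LinearMap.mulLeft F β ∘ₗ (FiniteField.frobeniusAlgHom F K).toLinearMap).graph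

theorem mem_twistedGraph {α β : K} {p : K × K} :
    p ∈ twistedGraph F α β ↔ p.2 = α * p.1 + β * p.1 ^ Fintype.card F := by
  simp [twistedGraph, LinearMap.mem_graph_iff]

theorem finrank_twistedGraph (hK : finrank F K = 2) (α β : K) :
    finrank F (twistedGraph F α β) = 2 := by
  rw [twistedGraph, LinearMap.graph_eq_range_prod, LinearMap.finrank_range_of_inj, hK]
  exact fun x y h ↦ congrArg Prod.fst h

theorem twistedGraph_inj {θ : K} (hθ : θ ^ Fintype.card F ≠ θ) {α β α' β' : K}
    (h : twistedGraph F α β = twistedGraph F α' β') : α = α' ∧ β = β' := by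
  have key (x : K) :
      α * x + β * x ^ Fintype.card F = α' * x + β' * x ^ Fintype.card F := by
    have hx : (x, α * x + β * x ^ Fintype.card F) ∈ twistedGraph F α' β' :=
      h ▸ mem_twistedGraph.2 rfl
    exact mem_twistedGraph.1 hx
  have h1 := key 1
  simp only [one_pow, mul_one] at h1
  have hβ : β = β' := by
    refine mul_right_cancel₀ (sub_ne_zero.2 hθ) ?_
    linear_combination key θ - θ * h1
  subst hβ
  exact ⟨add_right_cancel h1, rfl⟩

/-- The regular spread of `K × K`, indexed by `none`, and for each affine `F`-line
`r • transversal θ t + F • direction θ t` of `K` a Hall spread, obtained from a regular spread by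
reversing the regulus that corresponds to this affine line. -/
def hallSpreads (θ s c : K) : Option (Option F × F) → Set (Submodule F (K × K))
  | none => {W | W = LinearMap.range (LinearMap.inr F K K) ∨ ∃ m, W = twistedGraph F m 0}
  | some (t, r) => {W | (∃ u v : F, v ≠ 0 ∧ W = twistedGraph F
        (r • transversal θ t + u • direction θ t + v • (s * direction θ t))
        (v • (c * direction θ t ^ Fintype.card F))) ∨
      ∃ w, w ≠ 0 ∧ W = shearedPlane F (direction θ t) (r • transversal θ t) w}

theorem hallSpreads_cover (hK : finrank F K = 2) {θ s c : K} (hθ : ∀ a : F, a • (1 : K) ≠ θ)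
    (hsc : ∀ x : K, x ≠ 0 → ∀ a : F, a • x ≠ s * x + c * x ^ Fintype.card F)
    (i : Option (Option F × F)) (p : K × K) (hp : p ≠ 0) :
    ∃ W ∈ hallSpreads θ s c i, finrank F W = 2 ∧ p ∈ W := by
  obtain ⟨x, y⟩ := p
  match i with
  | none =>
    by_cases hx : x = 0
    · refine ⟨_, Or.inl rfl, ?_, y, by simp [hx]⟩
      rw [LinearMap.finrank_range_of_inj LinearMap.inr_injective, hK]
    · refine ⟨_, Or.inr ⟨y / x, rfl⟩, finrank_twistedGraph hK _ _, mem_twistedGraph.2 ?_⟩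
      simp [hx]
  | some (t, r) =>
    have hd := direction_ne_zero hθ t
    set d := direction θ t
    by_cases hx : x = 0
    · subst hx
      have hy : y ≠ 0 := fun h ↦ hp (by simp [h])
      have hw : y / d ≠ 0 := div_ne_zero hy hd
      refine ⟨_, Or.inr ⟨y / d, hw, rfl⟩, finrank_shearedPlane hd hw _,
        mem_shearedPlane.2 ⟨0, 1, by simp, ?_⟩⟩
      simp [d, mul_div_cancel₀ _ hd]
    · have hdx : d * x ≠ 0 := mul_ne_zero hd hx
      obtain ⟨u, v, huv⟩ := exists_smul_add_smul_eq hK hdx (hsc _ hdx)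
        (y - r • transversal θ t * x)
      by_cases hv : v = 0
      · refine ⟨_, Or.inr ⟨x, hx, rfl⟩, finrank_shearedPlane hd hx _,
          mem_shearedPlane.2 ⟨1, u, by simp, ?_⟩⟩
        rw [hv, zero_smul, add_zero] at huv
        rw [huv]
        simp
      · refine ⟨_, Or.inl ⟨u, v, hv, rfl⟩, finrank_twistedGraph hK _ _, mem_twistedGraph.2 ?_⟩
        simp only [Algebra.smul_def] at huv ⊢
        linear_combination -huv

theorem hallSpreads_disjoint {θ s c : K} (hθ : θ ^ Fintype.card F ≠ θ) (hc : c ≠ 0)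
    (i j : Option (Option F × F)) (W : Submodule F (K × K))
    (hi : W ∈ hallSpreads θ s c i) (hj : W ∈ hallSpreads θ s c j) : i = j := by
  have hθ' := smul_one_ne_of_pow_card_ne hθ
  have hgraph {x : K} {α β : K} (h : (0, x) ∈ twistedGraph F α β) : x = 0 := by
    simpa [mem_twistedGraph] using h
  have hnone {t : Option F} {r : F} (h : W ∈ hallSpreads θ s c (none : Option (Option F × F)))
      (h' : W ∈ hallSpreads θ s c (some (t, r))) : False := by
    have hd := direction_ne_zero hθ' t
    rcases h with rfl | ⟨m, rfl⟩
    · rcases h' with ⟨u, v, hv, h⟩ | ⟨w, hw, h⟩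
      · have h1 : ((0 : K), (1 : K)) ∈ LinearMap.range (LinearMap.inr F K K) := ⟨1, rfl⟩
        exact one_ne_zero (hgraph (h ▸ h1))
      · have : (w, r • transversal θ t * w) ∈ LinearMap.range (LinearMap.inr F K K) :=
          h ▸ mem_shearedPlane.2 ⟨1, 0, by simp, by simp⟩
        simp [hw.symm] at this
    · rcases h' with ⟨u, v, hv, h⟩ | ⟨w, hw, h⟩
      · exact smul_ne_zero hv (mul_ne_zero hc (pow_ne_zero _ hd)) (twistedGraph_inj hθ h).2.symm
      · exact mul_ne_zero hd hw (hgraph (h ▸ mem_shearedPlane.2 ⟨0, 1, by simp, by simp⟩))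
  match i, j with
  | none, none => rfl
  | none, some (t, r) => exact (hnone hi hj).elim
  | some (t, r), none => exact (hnone hj hi).elim
  | some (t, r), some (t', r') =>
    have hd := direction_ne_zero hθ' t
    have hd' := direction_ne_zero hθ' t'
    rcases hi with ⟨u, v, hv, rfl⟩ | ⟨w, hw, rfl⟩
    · rcases hj with ⟨u', v', hv', h⟩ | ⟨w, hw, h⟩
      · obtain ⟨hα, hβ⟩ := twistedGraph_inj hθ h
        have hfrob : (v • direction θ t) ^ Fintype.card F =
            (v' • direction θ t') ^ Fintype.card F := by
          refine mul_left_cancel₀ hc ?_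
          simpa [smul_pow, FiniteField.pow_card] using hβ
        obtain ⟨rfl, rfl⟩ := eq_and_eq_of_smul_direction_eq hθ' hv
          ((FiniteField.frobeniusAlgHom F K).injective hfrob)
        rw [eq_of_smul_transversal_add_eq hθ' (add_right_cancel hα)]
      · exact (mul_ne_zero hd' hw
          (hgraph (h ▸ mem_shearedPlane.2 ⟨0, 1, by simp, by simp⟩))).elim
    · rcases hj with ⟨u', v', hv', h⟩ | ⟨w', hw', h⟩
      · exact (mul_ne_zero hd hw
          (hgraph (h ▸ mem_shearedPlane.2 ⟨0, 1, by simp, by simp⟩))).elim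
      · have h0 : (0, direction θ t * w) ∈
            shearedPlane F (direction θ t') (r' • transversal θ t') w' :=
          h ▸ mem_shearedPlane.2 ⟨0, 1, by simp, by simp⟩
        have h1 : (w, r • transversal θ t * w) ∈
            shearedPlane F (direction θ t') (r' • transversal θ t') w' :=
          h ▸ mem_shearedPlane.2 ⟨1, 0, by simp, by simp⟩
        obtain ⟨a, b, ha, hb⟩ := mem_shearedPlane.1 h0
        obtain ⟨a', b', ha', hb'⟩ := mem_shearedPlane.1 h1
        obtain rfl : a = 0 := by simpa [hw', eq_comm] using ha
        simp only at ha' hb hb'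
        subst ha'
        have ha0 : a' ≠ 0 := fun h ↦ hw (by simp [h])
        have hdir : a' • direction θ t = b • direction θ t' := by
          refine mul_right_cancel₀ hw' ?_
          simpa using hb
        obtain ⟨rfl, rfl⟩ := eq_and_eq_of_smul_direction_eq hθ' ha0 hdir
        have hA0 : algebraMap F K a' ≠ 0 := by simpa using ha0
        have htr : r • transversal θ t + (0 : F) • direction θ t =
            r' • transversal θ t + (b' / a') • direction θ t := by
          simp only [Algebra.smul_def, map_div₀, map_zero] at hb' ⊢
          field_simp
          refine mul_right_cancel₀ hw' ?_
          linear_combination hb'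
        rw [eq_of_smul_transversal_add_eq hθ' htr]

end QuadraticExtension

section FieldWithTwoElements

variable {F : Type*} [Field F]

/-- The Plücker coordinates of a pair of vectors. -/
def pluecker (x y : Fin 4 → F) (i j : Fin 4) : F :=
  x i * y j - x j * y i

/-- A quadratic map on Plücker coordinates whose fibres over `F₂` are the spreads of a packing. -/
def quadraticColor (p : Fin 4 → Fin 4 → F) : Fin 3 → F :=
  ![p 0 3 + p 1 2 + p 1 3 + p 2 3 + p 1 3 * p 2 3,
    p 0 1 + p 2 3 + p 0 3 * p 1 3,
    p 0 2 + p 1 3 + p 2 3 + p 0 3 * p 2 3]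

theorem pluecker_map {E : Type*} [Field E] (φ : E →+* F) (x y : Fin 4 → E) :
    pluecker (φ ∘ x) (φ ∘ y) = fun i j ↦ φ (pluecker x y i j) := by
  ext i j
  simp [pluecker]

theorem quadraticColor_map {E : Type*} [Field E] (φ : E →+* F) (p : Fin 4 → Fin 4 → E) :
    quadraticColor (fun i j ↦ φ (p i j)) = φ ∘ quadraticColor p := by
  ext k
  fin_cases k <;> simp [quadraticColor]

theorem exists_quadraticColor_eq_zmod_two {x : Fin 4 → ZMod 2} (hx : x ≠ 0)
    {c : Fin 3 → ZMod 2} (hc : c ≠ 0) : ∃ y, quadraticColor (pluecker x y) = c := by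
  have key : ∀ x₀ x₁ x₂ x₃ c₀ c₁ c₂ : ZMod 2, ¬(x₀ = 0 ∧ x₁ = 0 ∧ x₂ = 0 ∧ x₃ = 0) →
      ¬(c₀ = 0 ∧ c₁ = 0 ∧ c₂ = 0) → ∃ y₀ y₁ y₂ y₃ : ZMod 2,
        (x₀ * y₃ - x₃ * y₀) + (x₁ * y₂ - x₂ * y₁) + (x₁ * y₃ - x₃ * y₁) +
          (x₂ * y₃ - x₃ * y₂) + (x₁ * y₃ - x₃ * y₁) * (x₂ * y₃ - x₃ * y₂) = c₀ ∧
        (x₀ * y₁ - x₁ * y₀) + (x₂ * y₃ - x₃ * y₂) +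
          (x₀ * y₃ - x₃ * y₀) * (x₁ * y₃ - x₃ * y₁) = c₁ ∧
        (x₀ * y₂ - x₂ * y₀) + (x₁ * y₃ - x₃ * y₁) + (x₂ * y₃ - x₃ * y₂) +
          (x₀ * y₃ - x₃ * y₀) * (x₂ * y₃ - x₃ * y₂) = c₂ := by
    decide
  obtain ⟨y₀, y₁, y₂, y₃, h₀, h₁, h₂⟩ := key (x 0) (x 1) (x 2) (x 3) (c 0) (c 1) (c 2)
    (fun ⟨h₀, h₁, h₂, h₃⟩ ↦ hx (by ext i; fin_cases i <;> assumption))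
    (fun ⟨h₀, h₁, h₂⟩ ↦ hc (by ext i; fin_cases i <;> assumption))
  refine ⟨![y₀, y₁, y₂, y₃], ?_⟩
  ext k
  fin_cases k <;> assumption

theorem linearIndependent_of_quadraticColor_ne_zero {x y : Fin 4 → F}
    (hc : quadraticColor (pluecker x y) ≠ 0) : LinearIndependent F ![x, y] := by
  have hzero {p : Fin 4 → Fin 4 → F} (hp : p = 0) : quadraticColor p = 0 := by
    subst hp
    ext k
    fin_cases k <;> simp [quadraticColor]
  have hx : x ≠ 0 := by
    rintro rfl
    exact hc (hzero (by ext i j; simp [pluecker]))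
  refine (LinearIndependent.pair_iff' hx).2 ?_
  rintro a rfl
  refine hc (hzero ?_)
  ext i j
  simp only [pluecker, Pi.smul_apply, smul_eq_mul, Pi.zero_apply]
  ring

variable [Fintype F]

theorem exists_quadraticColor_eq (hF : Fintype.card F = 2) {x : Fin 4 → F} (hx : x ≠ 0)
    {c : Fin 3 → F} (hc : c ≠ 0) : ∃ y, quadraticColor (pluecker x y) = c := by
  let φ : ZMod 2 ≃+* F := ZMod.ringEquivOfPrime F Nat.prime_two hF
  have hφ {ι : Type} (z : ι → F) : φ ∘ φ.symm ∘ z = z := by ext; simp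
  have hne {ι : Type} {z : ι → F} (hz : z ≠ 0) : φ.symm ∘ z ≠ 0 := by
    intro h
    apply hz
    rw [← hφ z, h]
    ext
    simp
  obtain ⟨y, hy⟩ := exists_quadraticColor_eq_zmod_two (hne hx) (hne hc)
  refine ⟨φ ∘ y, ?_⟩
  have h := pluecker_map (φ : ZMod 2 →+* F) (φ.symm ∘ x) y
  have h' := quadraticColor_map (φ : ZMod 2 →+* F) (pluecker (φ.symm ∘ x) y)
  rw [← h, hy] at h'
  simpa [hφ] using h'

theorem eq_zero_or_eq_one_of_card_eq_two (hF : Fintype.card F = 2) (a : F) :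
    a = 0 ∨ a = 1 := by
  have h := FiniteField.pow_card a
  rw [hF] at h
  have : a * (a - 1) = 0 := by linear_combination h
  simpa [sub_eq_zero] using this

theorem quadraticColor_eq_of_span_eq (hF : Fintype.card F = 2) {x y x' y' : Fin 4 → F}
    (h : Submodule.span F {x, y} = Submodule.span F {x', y'})
    (hc : quadraticColor (pluecker x' y') ≠ 0) :
    quadraticColor (pluecker x y) = quadraticColor (pluecker x' y') := by
  obtain ⟨a, b, rfl⟩ := Submodule.mem_span_pair.1
    (h ▸ Submodule.subset_span (by simp) : x' ∈ Submodule.span F {x, y})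
  obtain ⟨a', b', rfl⟩ := Submodule.mem_span_pair.1
    (h ▸ Submodule.subset_span (by simp) : y' ∈ Submodule.span F {x, y})
  have hdet : pluecker (a • x + b • y) (a' • x + b' • y) =
      (a * b' - b * a') • pluecker x y := by
    ext i j
    simp only [pluecker, Pi.add_apply, Pi.smul_apply, smul_eq_mul]
    ring
  rw [hdet] at hc ⊢
  rcases eq_zero_or_eq_one_of_card_eq_two hF (a * b' - b * a') with h0 | h1
  · refine absurd ?_ hc
    rw [h0, zero_smul]
    ext k
    fin_cases k <;> simp [quadraticColor]
  · rw [h1, one_smul]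

end FieldWithTwoElements

/-- For every finite field `F_q`, the graph whose vertices are the
2-dimensional subspaces of `F_q⁴` and whose edges are pairs of complementary subspaces
(the distant graph `G(M₂(q),Δ)`) admits a partition of its vertex set into `q² + q + 1`
pairwise vertex-disjoint maximal cliques, each of size `q² + 1`. -/
theorem distant_graph_M2_clique_partition (F : Type*) [Field F] [Fintype F] :
    ∃ f : {W : Submodule F (Fin 4 → F) // Module.finrank F W = 2} →
        Fin (Fintype.card F ^ 2 + Fintype.card F + 1),
      ∀ c,
        (∀ X Y, f X = c → f Y = c → X ≠ Y → IsCompl X.1 Y.1) ∧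
        Nat.card {X // f X = c} = Fintype.card F ^ 2 + 1 ∧
        (∀ X, f X ≠ c → ∃ Y, f Y = c ∧ ¬IsCompl X.1 Y.1) := by
  have hV : finrank F (Fin 4 → F) = 4 := by simp
  rcases (Nat.succ_le_of_lt (Fintype.one_lt_card (α := F))).eq_or_lt with hF | hF
  · refine exists_clique_partition hV (C := {c : Fin 3 → F // c ≠ 0}) ?_
      (fun c ↦ {W | ∃ x y, W = Submodule.span F {x, y} ∧ quadraticColor (pluecker x y) = c.1})
      (fun c v hv ↦ ?_) ?_
    · classical
      simp [Fintype.card_subtype_compl, ← hF]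
    · obtain ⟨y, hy⟩ := exists_quadraticColor_eq hF.symm hv c.2
      refine ⟨_, ⟨v, y, rfl, hy⟩, ?_, Submodule.subset_span (by simp)⟩
      have := finrank_span_eq_card
        (linearIndependent_of_quadraticColor_ne_zero (by rw [hy]; exact c.2))
      rwa [Matrix.range_cons_cons_empty, Fintype.card_fin] at this
    · rintro c c' W ⟨x, y, rfl, h⟩ ⟨x', y', hspan, h'⟩
      have := quadraticColor_eq_of_span_eq hF.symm hspan (by rw [h']; exact c'.2)
      exact Subtype.ext (h.symm.trans (this.trans h'))
  · obtain ⟨p, hp⟩ := CharP.exists F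
    have : Fact p.Prime := ⟨CharP.char_is_prime F p⟩
    let K := FiniteField.Extension F p 2
    have hK : finrank F K = 2 := FiniteField.finrank_extension F p 2
    obtain ⟨θ, hθ⟩ := exists_pow_card_ne_self hK
    obtain ⟨s, c, hc, hsc⟩ := exists_twisted_without_eigenvalue hK hF
    let e : (Fin 4 → F) ≃ₗ[F] K × K := LinearEquiv.ofFinrankEq _ _ (by simp [hK])
    refine exists_clique_partition hV (C := Option (Option F × F)) ?_
      (fun i ↦ {W | W.map e.toLinearMap ∈ hallSpreads θ s c i}) (fun i v hv ↦ ?_)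
      fun i j W hi hj ↦ hallSpreads_disjoint hθ hc i j _ hi hj
    · simp
      ring
    · obtain ⟨W, hW, hrank, hvW⟩ := hallSpreads_cover hK (smul_one_ne_of_pow_card_ne hθ) hsc i
        (e v) (by simpa using hv)
      have hmap : (W.comap e.toLinearMap).map e.toLinearMap = W :=
        Submodule.map_comap_eq_of_surjective e.surjective W
      refine ⟨W.comap e.toLinearMap, by simpa [hmap] using hW, ?_, hvW⟩
      rw [← e.finrank_map_eq, hmap, hrank]
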